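/- Let $X$ be a finite-dimensional real vector space with $\dim X = d$, $D \subseteq X$ a convex set, and $f, g \colon D \to \mathbb{R}$. Suppose that for all $n \le d + 2$, all $x_0, x_1, \dots, x_n \in D$, all $x \in \operatorname{conv}\{x_1, \dots, x_n\}$, and all $t \in [0,1]$, one has $f((1-t)x_0 + tx) \le (1-t)g(x_0) + t f(x)$. Then there exists a convex function $\varphi \colon D \to \mathbb{R}$ with $f \le \varphi \le g$ on $D$. -/

import Mathlib

/-- A set `S` containing `E`, and containing every segment between a point of `E` and a point
of `S`, contains the convex hull of `E`. -/
theorem convexHull_subset_of_segment_subset {V : Type*} [AddCommGroup V] [Module ℝ V]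
    {E S : Set V} (hES : E ⊆ S) (hseg : ∀ e ∈ E, ∀ s ∈ S, segment ℝ e s ⊆ S) :
    convexHull ℝ E ⊆ S := by
  classical
  have key : ∀ t : Finset V, (t : Set V) ⊆ E → convexHull ℝ (t : Set V) ⊆ S := by
    intro t
    induction t using Finset.induction_on with
    | empty => simp
    | insert a t _ ih =>
      intro ht
      rw [Finset.coe_insert] at ht ⊢
      have ha : a ∈ E := ht (Set.mem_insert _ _)
      rcases (t : Set V).eq_empty_or_nonempty with h0 | h0
      · simpa [h0] using hES ha
      · rw [convexHull_insert h0]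
        intro x hx
        obtain ⟨y, hy, hxy⟩ := by simpa [mem_convexJoin] using hx
        exact hseg a ha y (ih ((Set.subset_insert _ _).trans ht) hy) hxy
  rw [convexHull_eq_union_convexHull_finite_subsets]
  exact Set.iUnion₂_subset key

/-- The lower boundary of a convex subset of `X × ℝ` is a convex function on `D`, provided the
vertical fibres over `D` are nonempty and bounded below. -/
theorem Convex.convexOn_sInf_fiber {X : Type*} [AddCommGroup X] [Module ℝ X]
    {C : Set (X × ℝ)} (hC : Convex ℝ C) {D : Set X} (hD : Convex ℝ D)
    (hne : ∀ x ∈ D, {s : ℝ | (x, s) ∈ C}.Nonempty)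
    (hbdd : ∀ x ∈ D, BddBelow {s : ℝ | (x, s) ∈ C}) :
    ConvexOn ℝ D (fun x => sInf {s : ℝ | (x, s) ∈ C}) := by
  refine ⟨hD, fun x hx y hy a b ha hb hab => le_of_forall_pos_le_add fun ε hε => ?_⟩
  obtain ⟨s, hs, hsx⟩ := exists_lt_of_csInf_lt (hne x hx) (lt_add_of_pos_right _ hε)
  obtain ⟨r, hr, hry⟩ := exists_lt_of_csInf_lt (hne y hy) (lt_add_of_pos_right _ hε)
  have hmem : (a • x + b • y, a * s + b * r) ∈ C := by
    simpa using hC hs hr ha hb hab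
  have hle := csInf_le (hbdd _ (hD hx hy ha hb hab)) hmem
  have h₁ := mul_le_mul_of_nonneg_left hsx.le ha
  have h₂ := mul_le_mul_of_nonneg_left hry.le hb
  have h₃ : a * ε + b * ε = ε := by rw [← add_mul, hab, one_mul]
  simp only [smul_eq_mul]
  linarith

/-- Finite-dimensional refinement of the separation theorem: if `dim X = d`, it suffices to
assume the segment inequality for convex hulls of at most `d + 2` points (the Carathéodory
number of the vertical extension `X × ℝ`). -/
theorem convex_separation_of_segment_ineq_findim (X : Type*) [AddCommGroup X] [Module ℝ X]
    [FiniteDimensional ℝ X] (d : ℕ) (hd : Module.finrank ℝ X = d)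
    (D : Set X) (hD : Convex ℝ D) (f g : X → ℝ)
    (h : ∀ n ≤ d + 2, ∀ (x₀ : X), x₀ ∈ D → ∀ xs : Fin n → X, (∀ k, xs k ∈ D) →
      ∀ x ∈ convexHull ℝ (Set.range xs), ∀ t ∈ Set.Icc (0 : ℝ) 1,
      f ((1 - t) • x₀ + t • x) ≤ (1 - t) * g x₀ + t * f x) :
    ∃ φ : X → ℝ, ConvexOn ℝ D φ ∧ ∀ x ∈ D, f x ≤ φ x ∧ φ x ≤ g x := by
  have hpair : ∀ x₀ ∈ D, ∀ x ∈ D, ∀ t ∈ Set.Icc (0 : ℝ) 1,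
      f ((1 - t) • x₀ + t • x) ≤ (1 - t) * g x₀ + t * f x := fun x₀ hx₀ x hx =>
    h 1 (by omega) x₀ hx₀ (fun _ => x) (fun _ => hx) x
      (subset_convexHull ℝ _ (Set.mem_range_self 0))
  have hfg : ∀ x ∈ D, f x ≤ g x := fun x hx => by
    simpa using hpair x hx x hx 0 (by simp)
  let E : Set (X × ℝ) := {p | p.1 ∈ D ∧ p.2 = g p.1}
  have hsub : convexHull ℝ E ⊆ {p : X × ℝ | p.1 ∈ D ∧ f p.1 ≤ p.2} := by
    refine convexHull_subset_of_segment_subset (fun p hp => ⟨hp.1, hp.2 ▸ hfg _ hp.1⟩) ?_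
    rintro ⟨x₀, r⟩ ⟨hx₀, hr⟩ ⟨x, s⟩ ⟨hx, hs⟩ _ ⟨a, b, ha, hb, hab, rfl⟩
    dsimp only at hx₀ hr hx hs
    refine ⟨hD hx₀ hx ha hb hab, ?_⟩
    obtain rfl : a = 1 - b := by linarith
    have h₁ := hpair x₀ hx₀ x hx b ⟨hb, by linarith⟩
    have h₂ := mul_le_mul_of_nonneg_left hs hb
    simp only [Prod.smul_mk, Prod.mk_add_mk, smul_eq_mul, hr]
    linarith
  have hmem : ∀ x ∈ D, g x ∈ {s : ℝ | (x, s) ∈ convexHull ℝ E} := fun x hx =>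
    subset_convexHull ℝ E ⟨hx, rfl⟩
  have hlow : ∀ x, f x ∈ lowerBounds {s : ℝ | (x, s) ∈ convexHull ℝ E} := fun _ _ hs =>
    (hsub hs).2
  exact ⟨_, (convex_convexHull ℝ E).convexOn_sInf_fiber hD (fun x hx => ⟨_, hmem x hx⟩)
    (fun x _ => ⟨_, hlow x⟩), fun x hx =>
    ⟨le_csInf ⟨_, hmem x hx⟩ (hlow x), csInf_le ⟨_, hlow x⟩ (hmem x hx)⟩⟩
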